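/- arXiv:2602.02565 — 2 statements merged into one kernel-verified Lean document; each statement's English description precedes it below -/
import Mathlib

section
/- Let f₁ : ℝ^{n₁} → ℝ and f₂ : ℝ^{n₂} → ℝ be continuously differentiable, and define f : ℝ^{n₁}×ℝ^{n₂} → ℝ by f(x,y) = f₁(x) + f₂(y), so that ∇f(x,y) = (∇f₁(x), ∇f₂(y)). Let (x_t, y_t) be a sequence in ℝ^{n₁}×ℝ^{n₂}, and let (Δ_t) and (Λ_t) be sequences of directions that are gradient-related for f₁ along (x_t) and for f₂ along (y_t), respectively. Then the sequence of pairs (Δ_t, Λ_t) is gradient-related for f along (x_t, y_t). (A sequence of directions (z_t) is gradient-related for a C¹ function g along a sequence of points (p_t) if (z_t) is bounded and, for every subsequence of (p_t) converging to a point p with ∇g(p) ≠ 0, the corresponding subsequence of inner products ⟨∇g(p_t), z_t⟩ has negative limsup.) -/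
open scoped RealInnerProductSpace

/-- A sequence of directions `z` is *gradient-related* for a function `g` along a sequence
of points `p` if `z` is bounded and, for every subsequence of `p` converging to a
non-critical point of `g`, the corresponding inner products `⟪∇g(p_t), z_t⟫` have negative
`limsup`. -/
def GradientRelated {E : Type*} [NormedAddCommGroup E] [InnerProductSpace ℝ E]
    [CompleteSpace E] (g : E → ℝ) (p z : ℕ → E) : Prop :=
  (∃ C : ℝ, ∀ t, ‖z t‖ ≤ C) ∧
    ∀ φ : ℕ → ℕ, StrictMono φ → ∀ q : E,
      Filter.Tendsto (fun t => p (φ t)) Filter.atTop (nhds q) → gradient g q ≠ 0 →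
        Filter.limsup (fun t => ⟪gradient g (p (φ t)), z (φ t)⟫) Filter.atTop < 0

section

open Filter Topology

variable {E F : Type*} [NormedAddCommGroup E] [InnerProductSpace ℝ E]
  [NormedAddCommGroup F] [InnerProductSpace ℝ F]

theorem exists_eventually_abs_inner_le {u z : ℕ → E} {v : E} (hu : Tendsto u atTop (𝓝 v))
    {C : ℝ} (hz : ∀ t, ‖z t‖ ≤ C) : ∃ B, ∀ᶠ t in atTop, |⟪u t, z t⟫| ≤ B := by
  refine ⟨(‖v‖ + 1) * C, ?_⟩
  filter_upwards [hu.norm.eventually_le_const (lt_add_one ‖v‖)] with t ht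
  exact (abs_real_inner_le_norm _ _).trans
    (mul_le_mul ht (hz t) (norm_nonneg _) (by positivity))

theorem tendsto_inner_zero_of_bounded {u z : ℕ → E} (hu : Tendsto u atTop (𝓝 0))
    {C : ℝ} (hz : ∀ t, ‖z t‖ ≤ C) : Tendsto (fun t => ⟪u t, z t⟫) atTop (𝓝 0) := by
  have h : Tendsto (fun t => ‖u t‖ * C) atTop (𝓝 0) := by
    simpa using hu.norm.mul_const C
  exact squeeze_zero_norm (fun t => (abs_real_inner_le_norm _ _).trans
    (mul_le_mul_of_nonneg_left (hz t) (norm_nonneg _))) h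

variable [CompleteSpace E] [CompleteSpace F]

theorem ContDiff.continuous_gradient {g : E → ℝ} (hg : ContDiff ℝ 1 g) :
    Continuous (gradient g) :=
  (InnerProductSpace.toDual ℝ E).symm.continuous.comp (hg.continuous_fderiv one_ne_zero)

theorem HasGradientAt.add_withLp_prod {f₁ : E → ℝ} {f₂ : F → ℝ} {a a' : E} {b b' : F}
    (h₁ : HasGradientAt f₁ a' a) (h₂ : HasGradientAt f₂ b' b) :
    HasGradientAt (fun w : WithLp 2 (E × F) => f₁ w.fst + f₂ w.snd)
      (WithLp.toLp 2 (a', b')) (WithLp.toLp 2 (a, b)) := by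
  rw [hasGradientAt_iff_hasFDerivAt] at *
  have hfst : HasFDerivAt (fun w : WithLp 2 (E × F) => w.fst) (WithLp.fstL 2 ℝ E F)
      (WithLp.toLp 2 (a, b)) := (WithLp.fstL 2 ℝ E F).hasFDerivAt
  have hsnd : HasFDerivAt (fun w : WithLp 2 (E × F) => w.snd) (WithLp.sndL 2 ℝ E F)
      (WithLp.toLp 2 (a, b)) := (WithLp.sndL 2 ℝ E F).hasFDerivAt
  refine ((HasFDerivAt.comp (WithLp.toLp 2 (a, b)) h₁ hfst).add
    (HasFDerivAt.comp (WithLp.toLp 2 (a, b)) h₂ hsnd)).congr_fderiv ?_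
  ext w
  simp [WithLp.prod_inner_apply]

theorem GradientRelated.limsup_nonpos {g : E → ℝ} {p z : ℕ → E} (h : GradientRelated g p z)
    (hg : ContDiff ℝ 1 g) {φ : ℕ → ℕ} (hφ : StrictMono φ) {q : E}
    (hq : Tendsto (fun t => p (φ t)) atTop (𝓝 q)) :
    limsup (fun t => ⟪gradient g (p (φ t)), z (φ t)⟫) atTop ≤ 0 := by
  by_cases h0 : gradient g q = 0
  · obtain ⟨C, hC⟩ := h.1
    have hu := (hg.continuous_gradient.tendsto q).comp hq
    rw [h0] at hu
    exact (tendsto_inner_zero_of_bounded hu fun t => hC (φ t)).limsup_eq.le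
  · exact (h.2 φ hφ q hq h0).le

theorem GradientRelated.isBoundedUnder_abs_inner {g : E → ℝ} {p z : ℕ → E}
    (h : GradientRelated g p z) (hg : ContDiff ℝ 1 g) {φ : ℕ → ℕ} {q : E}
    (hq : Tendsto (fun t => p (φ t)) atTop (𝓝 q)) :
    IsBoundedUnder (· ≤ ·) atTop (fun t => |⟪gradient g (p (φ t)), z (φ t)⟫|) := by
  obtain ⟨C, hC⟩ := h.1
  obtain ⟨B, hB⟩ := exists_eventually_abs_inner_le
    ((hg.continuous_gradient.tendsto q).comp hq) fun t => hC (φ t)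
  exact isBoundedUnder_of_eventually_le hB

theorem GradientRelated.add_withLp_prod {f₁ : E → ℝ} {f₂ : F → ℝ}
    (hf₁ : ContDiff ℝ 1 f₁) (hf₂ : ContDiff ℝ 1 f₂) {x Δ : ℕ → E} {y Λ : ℕ → F}
    (hΔ : GradientRelated f₁ x Δ) (hΛ : GradientRelated f₂ y Λ) :
    GradientRelated (fun w : WithLp 2 (E × F) => f₁ w.fst + f₂ w.snd)
      (fun t => WithLp.toLp 2 (x t, y t)) (fun t => WithLp.toLp 2 (Δ t, Λ t)) := by
  have hgrad (a : E) (b : F) :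
      gradient (fun w : WithLp 2 (E × F) => f₁ w.fst + f₂ w.snd) (WithLp.toLp 2 (a, b)) =
        WithLp.toLp 2 (gradient f₁ a, gradient f₂ b) :=
    ((hf₁.differentiable one_ne_zero a).hasGradientAt.add_withLp_prod
      (hf₂.differentiable one_ne_zero b).hasGradientAt).gradient
  constructor
  · obtain ⟨C, hC⟩ := hΔ.1
    obtain ⟨D, hD⟩ := hΛ.1
    refine ⟨√(C ^ 2 + D ^ 2), fun t => ?_⟩
    rw [WithLp.prod_norm_eq_of_L2]
    have h₁ := hC t
    have h₂ := hD t
    gcongr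
    exacts [h₁, h₂]
  · intro φ hφ q hq hne
    have hx : Tendsto (fun t => x (φ t)) atTop (𝓝 q.fst) :=
      ((WithLp.fstL 2 ℝ E F).continuous.tendsto q).comp hq
    have hy : Tendsto (fun t => y (φ t)) atTop (𝓝 q.snd) :=
      ((WithLp.sndL 2 ℝ E F).continuous.tendsto q).comp hq
    have hb₁ := isBoundedUnder_le_abs.mp (hΔ.isBoundedUnder_abs_inner hf₁ hx)
    have hb₂ := isBoundedUnder_le_abs.mp (hΛ.isBoundedUnder_abs_inner hf₂ hy)
    have hn₁ := hΔ.limsup_nonpos hf₁ hφ hx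
    have hn₂ := hΛ.limsup_nonpos hf₂ hφ hy
    simp only [hgrad, WithLp.prod_inner_apply]
    refine (limsup_add_le hb₁.2 hb₁.1 hb₂.2.isCoboundedUnder_le hb₂.1).trans_lt ?_
    by_cases h₁ : gradient f₁ q.fst = 0
    · have h₂ : gradient f₂ q.snd ≠ 0 := by
        intro h₂
        refine hne ((hgrad q.fst q.snd).trans ?_)
        rw [h₁, h₂]
        rfl
      exact add_neg_of_nonpos_of_neg hn₁ (hΛ.2 φ hφ _ hy h₂)
    · exact add_neg_of_neg_of_nonpos (hΔ.2 φ hφ _ hx h₁) hn₂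

end

/-- If `f(x,y) = f₁(x) + f₂(y)` with `f₁, f₂` continuously differentiable
(so that `∇f(x,y) = (∇f₁(x), ∇f₂(y))`), `(Δ_t)` is gradient-related for `f₁` along `(x_t)`,
and `(Λ_t)` is gradient-related for `f₂` along `(y_t)`, then the pairs `(Δ_t, Λ_t)` are
gradient-related for `f` along `(x_t, y_t)` (the product carrying the `L²` inner
product). -/
theorem stmt12 {n₁ n₂ : ℕ}
    (f₁ : EuclideanSpace ℝ (Fin n₁) → ℝ) (f₂ : EuclideanSpace ℝ (Fin n₂) → ℝ)
    (hf₁ : ContDiff ℝ 1 f₁) (hf₂ : ContDiff ℝ 1 f₂)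
    (x Δ : ℕ → EuclideanSpace ℝ (Fin n₁)) (y Λ : ℕ → EuclideanSpace ℝ (Fin n₂))
    (hΔ : GradientRelated f₁ x Δ) (hΛ : GradientRelated f₂ y Λ) :
    GradientRelated
      (fun w : WithLp 2 (EuclideanSpace ℝ (Fin n₁) × EuclideanSpace ℝ (Fin n₂)) =>
        f₁ (WithLp.equiv 2 _ w).1 + f₂ (WithLp.equiv 2 _ w).2)
      (fun t => (WithLp.equiv 2 _).symm (x t, y t))
      (fun t => (WithLp.equiv 2 _).symm (Δ t, Λ t)) := by
  exact hΔ.add_withLp_prod hf₁ hf₂ hΛ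
end

section
/- Let f : ℝ^n → ℝ be continuously differentiable and bounded below. Consider the gradient descent sequence x_{t+1} = x_t − η_t ∇f(x_t), where each step size η_t = β^{ν_t} η₀ is chosen by Armijo backtracking: η₀ > 0, β, γ ∈ (0,1), and ν_t is the smallest nonnegative integer with f(x_t) − f(x_t − β^{ν_t} η₀ ∇f(x_t)) ≥ γ β^{ν_t} η₀ ‖∇f(x_t)‖². Then every accumulation point x* of the sequence (x_t) is a critical point of f, i.e., ∇f(x*) = 0. -/
open scoped RealInnerProductSpace

open Filter Topology in
/-- Near a non-critical point of a `C¹` function, the Armijo condition holds uniformly for all small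
step sizes. -/
theorem eventually_armijo {E : Type*} [NormedAddCommGroup E] [InnerProductSpace ℝ E]
    [CompleteSpace E] {f : E → ℝ} (hf : ContDiff ℝ 1 f) {γ : ℝ} (hγ : γ < 1) {x : E}
    (hx : gradient f x ≠ 0) :
    ∀ᶠ p : E × ℝ in 𝓝 x ×ˢ 𝓝 0, 0 ≤ p.2 →
      γ * p.2 * ‖gradient f p.1‖ ^ 2 ≤ f p.1 - f (p.1 - p.2 • gradient f p.1) := by
  have hg : Continuous (gradient f) :=
    (InnerProductSpace.toDual ℝ E).symm.continuous.comp (hf.continuous_fderiv one_ne_zero)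
  set c : ℝ := (1 - γ) * ‖gradient f x‖ / 2 with hc
  have hpos : 0 < (1 - γ) * ‖gradient f x‖ := mul_pos (by linarith) (norm_pos_iff.2 hx)
  have hstrict : HasStrictFDerivAt f (fderiv ℝ f x) x :=
    hf.contDiffAt.hasStrictFDerivAt one_ne_zero
  have hlim : Tendsto (fun p : E × ℝ => (p.1 - p.2 • gradient f p.1, p.1))
      (𝓝 x ×ˢ 𝓝 0) (𝓝 (x, x)) := by
    rw [← nhds_prod_eq]
    refine Continuous.tendsto' (by fun_prop) _ _ (by simp)
  have hgap : ∀ᶠ p : E × ℝ in 𝓝 x ×ˢ 𝓝 0,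
      ‖gradient f x - gradient f p.1‖ + c < (1 - γ) * ‖gradient f p.1‖ := by
    rw [← nhds_prod_eq]
    refine (ContinuousAt.eventually_lt (f := fun p : E × ℝ => ‖gradient f x - gradient f p.1‖ + c)
      (g := fun p : E × ℝ => (1 - γ) * ‖gradient f p.1‖) ?_ ?_ ?_)
    · exact Continuous.continuousAt (by fun_prop)
    · exact Continuous.continuousAt (by fun_prop)
    · simp only [sub_self, norm_zero]
      linarith
  filter_upwards [hlim.eventually (hstrict.isLittleO.def (show 0 < c by linarith)), hgap]
    with ⟨y, s⟩ hs hy hs0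
  simp only at hs hy hs0 ⊢
  set g := gradient f y
  have hcs : -(‖gradient f x - g‖ * ‖g‖) ≤ ⟪gradient f x - g, g⟫ :=
    neg_le_of_abs_le (abs_real_inner_le_norm _ _)
  rw [sub_sub_cancel_left, map_neg, map_smul, ← inner_gradient_left, norm_neg, norm_smul,
    Real.norm_of_nonneg hs0, smul_eq_mul, Real.norm_eq_abs] at hs
  rw [inner_sub_left, real_inner_self_eq_norm_sq] at hcs
  have h₁ := (abs_le.1 hs).2
  have h₂ := mul_le_mul_of_nonneg_left hcs hs0
  have h₃ := mul_le_mul_of_nonneg_left hy.le (mul_nonneg hs0 (norm_nonneg g))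
  linarith

/-- Consecutive differences of an antitone real sequence that is bounded below tend to zero. -/
theorem Antitone.tendsto_sub_succ_of_bddBelow {u : ℕ → ℝ} (hu : Antitone u)
    (hb : BddBelow (Set.range u)) :
    Filter.Tendsto (fun t => u t - u (t + 1)) Filter.atTop (nhds 0) := by
  have h := tendsto_atTop_ciInf hu hb
  simpa using h.sub (h.comp (Filter.tendsto_add_atTop_nat 1))

/-- Let `f : ℝ^n → ℝ` be `C¹` and bounded below, and consider gradient
descent `x_{t+1} = x_t − η_t ∇f(x_t)` with Armijo backtracking step sizes
`η_t = β^{ν_t} η₀`, where `ν_t` is the smallest nonnegative integer with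
`f(x_t) − f(x_t − β^{ν_t} η₀ ∇f(x_t)) ≥ γ β^{ν_t} η₀ ‖∇f(x_t)‖²`.  Then every accumulation
point of `(x_t)` is a critical point of `f`. -/
theorem stmt14 {n : ℕ} (f : EuclideanSpace ℝ (Fin n) → ℝ) (hf : ContDiff ℝ 1 f)
    (hbdd : BddBelow (Set.range f))
    (η₀ β γ : ℝ) (hη₀ : 0 < η₀) (hβ : β ∈ Set.Ioo (0 : ℝ) 1) (hγ : γ ∈ Set.Ioo (0 : ℝ) 1)
    (x : ℕ → EuclideanSpace ℝ (Fin n)) (ν : ℕ → ℕ)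
    (hν : ∀ t, IsLeast {k : ℕ |
      f (x t) - f (x t - (β ^ k * η₀) • gradient f (x t)) ≥
        γ * (β ^ k * η₀) * ‖gradient f (x t)‖ ^ 2} (ν t))
    (hupd : ∀ t, x (t + 1) = x t - (β ^ ν t * η₀) • gradient f (x t))
    (xstar : EuclideanSpace ℝ (Fin n)) (φ : ℕ → ℕ) (hφ : StrictMono φ)
    (hconv : Filter.Tendsto (fun t => x (φ t)) Filter.atTop (nhds xstar)) :
    gradient f xstar = 0 := by
  obtain ⟨hβ0, hβ1⟩ := hβ
  have hstep : ∀ k : ℕ, 0 < β ^ k * η₀ := fun k => mul_pos (pow_pos hβ0 k) hη₀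
  have hdec : ∀ t, γ * (β ^ ν t * η₀) * ‖gradient f (x t)‖ ^ 2 ≤ f (x t) - f (x (t + 1)) := by
    intro t
    rw [hupd t]
    exact (hν t).1
  have hanti : Antitone (f ∘ x) := antitone_nat_of_succ_le fun t => by
    have h : 0 ≤ γ * (β ^ ν t * η₀) * ‖gradient f (x t)‖ ^ 2 :=
      mul_nonneg (mul_pos hγ.1 (hstep _)).le (sq_nonneg _)
    exact sub_nonneg.1 (h.trans (hdec t))
  have hzero := (hanti.tendsto_sub_succ_of_bddBelow
    (hbdd.mono (Set.range_comp_subset_range x f))).comp hφ.tendsto_atTop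
  by_contra hne
  have hpow : Filter.Tendsto (fun k : ℕ => β ^ k * η₀) Filter.atTop (nhds 0) := by
    simpa using (tendsto_pow_atTop_nhds_zero_of_lt_one hβ0.le hβ1).mul_const η₀
  obtain ⟨P, hP, Q, hQ, hPQ⟩ := Filter.eventually_prod_iff.1 (eventually_armijo hf hγ.2 hne)
  obtain ⟨K, hK⟩ := (hpow.eventually hQ).exists
  have hg : Continuous (gradient f) :=
    (InnerProductSpace.toDual ℝ _).symm.continuous.comp (hf.continuous_fderiv one_ne_zero)
  have hlim : Filter.Tendsto (fun t => γ * (β ^ K * η₀) * ‖gradient f (x (φ t))‖ ^ 2)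
      Filter.atTop (nhds (γ * (β ^ K * η₀) * ‖gradient f xstar‖ ^ 2)) :=
    ((((hg.tendsto xstar).comp hconv).norm).pow 2).const_mul _
  have hle := le_of_tendsto_of_tendsto hlim hzero <| by
    filter_upwards [hconv.eventually hP] with t ht
    have hνK : ν (φ t) ≤ K := (hν (φ t)).2 (hPQ ht hK (hstep K).le)
    refine le_trans ?_ (hdec (φ t))
    have := pow_le_pow_of_le_one hβ0.le hβ1.le hνK
    have := hγ.1.le
    gcongr
  exact hle.not_gt (mul_pos (mul_pos hγ.1 (hstep K)) (pow_pos (norm_pos_iff.2 hne) 2))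
end
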